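/- arXiv:2006.13735 — 5 statements merged into one kernel-verified Lean document; each statement's English description precedes it below -/
import Mathlib

section
/- Let W be a real m×n matrix and b ∈ ℝ^m. Let z, ẑ ∈ ℝⁿ be the activations of a layer in the original and the abstracted network respectively, and let err = ẑ − z. Let z' = ReLU(W·z + b) be the next-layer activations of the original network, and let z̃ ∈ ℝ^m be any vector (the next-layer activations after additionally clustering that layer) satisfying, for every index j, |z̃_j − ReLU(W·ẑ + b)_j| ≤ ε_j, where ε ∈ ℝ^m is the vector of maximal distances of neurons from their cluster representatives. Then the accumulated absolute error in the next layer satisfies, for every index j, |z̃_j − z'_j| ≤ |(W·err)_j| + ε_j. -/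
noncomputable def relu (x : ℝ) : ℝ := max 0 x

/-- **Clustering-induced error, one layer (Theorem 1).** If `zhat` are the (abstract) activations
of a layer with error `err = zhat - z`, `z' = ReLU(W·z + b)` the exact next-layer activations, and
`z̃` deviates from `ReLU(W·zhat + b)` by at most `ε` componentwise (clustering error), then
`|z̃ - z'| ≤ |W·err| + ε` componentwise. -/
theorem clustering_induced_error (m n : ℕ) (W : Matrix (Fin m) (Fin n) ℝ) (b : Fin m → ℝ)
    (z zhat : Fin n → ℝ) (ztil : Fin m → ℝ) (ε : Fin m → ℝ)
    (hcluster : ∀ j, |ztil j - relu (W.mulVec zhat j + b j)| ≤ ε j) :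
    ∀ j, |ztil j - relu (W.mulVec z j + b j)| ≤ |W.mulVec (zhat - z) j| + ε j := by
  intro j
  have h := hcluster j
  have h2 : |relu (W.mulVec zhat j + b j) - relu (W.mulVec z j + b j)|
      ≤ |W.mulVec (zhat - z) j| := by
    have h3 := abs_max_sub_max_le_abs (W.mulVec zhat j + b j) (W.mulVec z j + b j) 0
    rw [Matrix.mulVec_sub, Pi.sub_apply]
    unfold relu
    rw [max_comm 0, max_comm 0]
    simpa using h3
  have h4 := abs_sub_le (ztil j) (relu (W.mulVec zhat j + b j)) (relu (W.mulVec z j + b j))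
  linarith
end

section
/- Let L ≥ 1 and for each ℓ with 1 ≤ ℓ < L let W^{(ℓ)} ∈ ℝ^{n_{ℓ+1}×n_ℓ} and b^{(ℓ+1)} ∈ ℝ^{n_{ℓ+1}}. Let z^{(ℓ)} be defined by z^{(ℓ+1)} = ReLU(W^{(ℓ)}·z^{(ℓ)} + b^{(ℓ+1)}) from a starting vector z^{(1)}, and let z̃^{(ℓ)} ∈ ℝ^{n_ℓ} be any sequence of vectors with z̃^{(1)} = z^{(1)} and satisfying, for each ℓ and each index j, |z̃^{(ℓ+1)}_j − ReLU(W^{(ℓ)}·z̃^{(ℓ)} + b^{(ℓ+1)})_j| ≤ ε^{(ℓ+1)}_j for given nonnegative vectors ε^{(ℓ+1)} ∈ ℝ^{n_{ℓ+1}}. Define error bounds E^{(1)} = 0 and E^{(ℓ+1)} = |W^{(ℓ)}|·E^{(ℓ)} + ε^{(ℓ+1)}, where |W^{(ℓ)}| is the matrix of entrywise absolute values. Then for every layer ℓ and every index j, |z̃^{(ℓ)}_j − z^{(ℓ)}_j| ≤ E^{(ℓ)}_j. -/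
/-- **Accumulated clustering-induced error (Theorem 1, accumulated form).**
Layers are indexed `0, …, L` with `0` the input layer. The exact activations satisfy
`z (ℓ+1) = ReLU(W ℓ · z ℓ + b ℓ)`; the abstract activations `z̃` start from the same input
and at each layer deviate from the exact ReLU propagation of the previous abstract layer by
at most `ε (ℓ+1)` componentwise. With `E 0 = 0` and `E (ℓ+1) = |W ℓ| · E ℓ + ε (ℓ+1)`
(entrywise absolute values), the accumulated error satisfies `|z̃ ℓ - z ℓ| ≤ E ℓ`
componentwise for every layer `ℓ ≤ L`. -/
theorem accumulated_clustering_error (n : ℕ → ℕ) (L : ℕ) (hL : 1 ≤ L)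
    (W : ∀ ℓ : ℕ, Matrix (Fin (n (ℓ + 1))) (Fin (n ℓ)) ℝ)
    (b : ∀ ℓ : ℕ, Fin (n (ℓ + 1)) → ℝ)
    (z ztil E ε : ∀ ℓ : ℕ, Fin (n ℓ) → ℝ)
    (hz : ∀ ℓ < L, ∀ j, z (ℓ + 1) j = relu ((W ℓ).mulVec (z ℓ) j + b ℓ j))
    (hstart : ztil 0 = z 0)
    (hε : ∀ ℓ ≤ L, ∀ j, 0 ≤ ε ℓ j)
    (htil : ∀ ℓ < L, ∀ j,
      |ztil (ℓ + 1) j - relu ((W ℓ).mulVec (ztil ℓ) j + b ℓ j)| ≤ ε (ℓ + 1) j)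
    (hE0 : ∀ j, E 0 j = 0)
    (hE : ∀ ℓ < L, ∀ j,
      E (ℓ + 1) j = (Matrix.of fun a c => |W ℓ a c|).mulVec (E ℓ) j + ε (ℓ + 1) j) :
    ∀ ℓ ≤ L, ∀ j, |ztil ℓ j - z ℓ j| ≤ E ℓ j := by
  intro ℓ
  induction ℓ with
  | zero =>
    intro _ j
    rw [hstart, hE0]
    simp
  | succ k ih =>
    intro hk j
    have hk' : k < L := hk
    have ih' := ih hk'.le
    rw [hE k hk' j, hz k hk' j]
    have h1 : |relu ((W k).mulVec (ztil k) j + b k j) - relu ((W k).mulVec (z k) j + b k j)|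
        ≤ |(W k).mulVec (ztil k) j - (W k).mulVec (z k) j| := by
      have h := abs_max_sub_max_le_abs ((W k).mulVec (ztil k) j + b k j)
        ((W k).mulVec (z k) j + b k j) 0
      rw [add_sub_add_right_eq_sub] at h
      unfold relu
      rw [max_comm 0, max_comm 0]
      exact h
    have h2 : |(W k).mulVec (ztil k) j - (W k).mulVec (z k) j|
        ≤ (Matrix.of fun a c => |W k a c|).mulVec (E k) j := by
      simp only [Matrix.mulVec, dotProduct, Matrix.of_apply]
      rw [← Finset.sum_sub_distrib]
      refine (Finset.abs_sum_le_sum_abs _ _).trans (Finset.sum_le_sum fun i _ => ?_)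
      rw [← mul_sub, abs_mul]
      exact mul_le_mul_of_nonneg_left (ih' i) (abs_nonneg _)
    have h3 := abs_sub_le (ztil (k + 1) j) (relu ((W k).mulVec (ztil k) j + b k j))
      (relu ((W k).mulVec (z k) j + b k j))
    have h4 := htil k hk' j
    linarith
end

section
/- Let D be a feedforward ReLU network with layers 1,…,L, weight matrices W^{(ℓ)}, biases b^{(ℓ+1)} and activations z^{(ℓ)}(x), and let D̃ be a feedforward ReLU network with the same layer dimensions, weight matrices W̃^{(ℓ)}, biases b̃^{(ℓ+1)} and activations z̃^{(ℓ)}(x). Fix an input x ∈ ℝ^{n_1} and suppose the abstraction error at x is bounded componentwise: |z̃^{(L)}(x)_j − z^{(L)}(x)_j| ≤ E_j for all output indices j, for some E ∈ ℝ^{n_L}. Let δ ∈ ℝ^{n_1} be nonnegative and let x' be any input with |x'_i − x_i| ≤ δ_i for all i. Then the total error satisfies, for every output index j, |z̃^{(L)}(x')_j − z^{(L)}(x)_j| ≤ (|W̃^{(L-1)}|·…·|W̃^{(1)}|·δ)_j + E_j. -/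
/-- Activations of a feedforward ReLU network: layer `0` is the input layer and
`netActs n W b x ℓ` are the activations of layer `ℓ` on input `x`. -/
noncomputable def netActs (n : ℕ → ℕ)
    (W : ∀ ℓ : ℕ, Matrix (Fin (n (ℓ + 1))) (Fin (n ℓ)) ℝ)
    (b : ∀ ℓ : ℕ, Fin (n (ℓ + 1)) → ℝ)
    (x : Fin (n 0) → ℝ) : ∀ ℓ : ℕ, Fin (n ℓ) → ℝ
  | 0 => x
  | ℓ + 1 => fun j => relu ((W ℓ).mulVec (netActs n W b x ℓ) j + b ℓ j)

/-- `propAbs n W v ℓ = |W (ℓ-1)| ⬝ ⋯ ⬝ |W 0| ⬝ v`. -/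
noncomputable def propAbs (n : ℕ → ℕ)
    (W : ∀ ℓ : ℕ, Matrix (Fin (n (ℓ + 1))) (Fin (n ℓ)) ℝ)
    (v : Fin (n 0) → ℝ) : ∀ ℓ : ℕ, Fin (n ℓ) → ℝ
  | 0 => v
  | ℓ + 1 => (Matrix.of fun a c => |W ℓ a c|).mulVec (propAbs n W v ℓ)

theorem relu_sub_le (a c : ℝ) : |relu a - relu c| ≤ |a - c| := by
  unfold relu
  have := abs_max_sub_max_le_abs a c 0
  rwa [max_comm a, max_comm c] at this

theorem perturb_bound (n : ℕ → ℕ)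
    (W : ∀ ℓ : ℕ, Matrix (Fin (n (ℓ + 1))) (Fin (n ℓ)) ℝ)
    (b : ∀ ℓ : ℕ, Fin (n (ℓ + 1)) → ℝ)
    (x x' δ : Fin (n 0) → ℝ) (hx' : ∀ i, |x' i - x i| ≤ δ i) (L : ℕ) :
    ∀ j, |netActs n W b x' L j - netActs n W b x L j| ≤ propAbs n W δ L j := by
  induction L with
  | zero => exact hx'
  | succ l ih =>
    intro j
    simp only [netActs, propAbs]
    refine (relu_sub_le _ _).trans ?_
    rw [add_sub_add_right_eq_sub]
    simp only [Matrix.mulVec, dotProduct, Matrix.of_apply]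
    rw [← Finset.sum_sub_distrib]
    refine (Finset.abs_sum_le_sum_abs _ _).trans (Finset.sum_le_sum fun i _ => ?_)
    rw [← mul_sub, abs_mul]
    exact mul_le_mul_of_nonneg_left (ih i) (abs_nonneg _)

/-- **Total error under abstraction and input perturbation (Theorem 2).**
`D` has weights `W`, biases `b`; the abstraction `D̃` has weights `Wt`, biases `bt` and the
same layer dimensions. If the abstraction error at `x` is bounded componentwise by `E`, `δ ≥ 0`
and `x'` lies in the `δ`-box around `x`, then
`|D̃(x') - D(x)| ≤ |W̃^{(L-1)}|⋯|W̃^{(0)}|·δ + E` componentwise. -/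
theorem total_error_bound (n : ℕ → ℕ) (L : ℕ)
    (W Wt : ∀ ℓ : ℕ, Matrix (Fin (n (ℓ + 1))) (Fin (n ℓ)) ℝ)
    (b bt : ∀ ℓ : ℕ, Fin (n (ℓ + 1)) → ℝ)
    (x : Fin (n 0) → ℝ) (E : Fin (n L) → ℝ)
    (hE : ∀ j, |netActs n Wt bt x L j - netActs n W b x L j| ≤ E j)
    (δ : Fin (n 0) → ℝ) (hδ : ∀ i, 0 ≤ δ i)
    (x' : Fin (n 0) → ℝ) (hx' : ∀ i, |x' i - x i| ≤ δ i) :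
    ∀ j, |netActs n Wt bt x' L j - netActs n W b x L j| ≤ propAbs n Wt δ L j + E j := by
  intro j
  exact (abs_sub_le _ (netActs n Wt bt x L j) _).trans
    (add_le_add (perturb_bound n Wt bt x x' δ hx' L j) (hE j))
end

section
/- Let W be a real m×n matrix and b ∈ ℝ^m. Let rep : {1,…,n} → {1,…,n} be an idempotent map (rep(rep(i)) = rep(i) for all i) assigning to each neuron its cluster representative, and let ε ∈ ℝⁿ be nonnegative. Let u, l, û, l̂ ∈ ℝⁿ satisfy, for every i: u_i ≤ û_{rep(i)} + ε_{rep(i)} and l_i ≥ l̂_{rep(i)} − ε_{rep(i)}. Define, for each output index j, the original propagated bounds u'_j = max(0, Σ_{i=1}^n [(W_{ji})⁺·u_i + (W_{ji})⁻·l_i] + b_j) and l'_j = max(0, Σ_{i=1}^n [(W_{ji})⁺·l_i + (W_{ji})⁻·u_i] + b_j), and the abstract propagated bounds û'_j = max(0, Σ_{i=1}^n [(W_{ji})⁺·(û_{rep(i)} + ε_{rep(i)}) + (W_{ji})⁻·(l̂_{rep(i)} − ε_{rep(i)})] + b_j) and l̂'_j = max(0, Σ_{i=1}^n [(W_{ji})⁺·(l̂_{rep(i)}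 − ε_{rep(i)}) + (W_{ji})⁻·(û_{rep(i)} + ε_{rep(i)})] + b_j). Then for every j, u'_j ≤ û'_j and l'_j ≥ l̂'_j. -/
/-- **Single-layer inductive step of the proof-lifting theorem (Theorem 3, one layer).**
`rep` is an idempotent cluster-representative map, `ε ≥ 0` the cluster radii. If the original
bounds `u, l` of each neuron are within the inflated abstract bounds of its representative,
then after propagation through one ReLU layer the inflated abstract interval bounds dominate
the original ones: `u' ≤ û'` and `l̂' ≤ l'` componentwise. -/
theorem proof_lifting_step (m n : ℕ) (W : Matrix (Fin m) (Fin n) ℝ) (b : Fin m → ℝ)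
    (rep : Fin n → Fin n) (hrep : ∀ i, rep (rep i) = rep i)
    (ε : Fin n → ℝ) (hε : ∀ i, 0 ≤ ε i)
    (u l uh lh : Fin n → ℝ)
    (hu : ∀ i, u i ≤ uh (rep i) + ε (rep i))
    (hl : ∀ i, lh (rep i) - ε (rep i) ≤ l i) :
    ∀ j,
      max 0 ((∑ i, (max 0 (W j i) * u i + min (W j i) 0 * l i)) + b j)
        ≤ max 0 ((∑ i, (max 0 (W j i) * (uh (rep i) + ε (rep i))
            + min (W j i) 0 * (lh (rep i) - ε (rep i)))) + b j) ∧
      max 0 ((∑ i, (max 0 (W j i) * (lh (rep i) - ε (rep i))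
            + min (W j i) 0 * (uh (rep i) + ε (rep i)))) + b j)
        ≤ max 0 ((∑ i, (max 0 (W j i) * l i + min (W j i) 0 * u i)) + b j) := by
  intro j
  have hp : ∀ i, 0 ≤ max 0 (W j i) := fun i => le_max_left _ _
  have hm : ∀ i, min (W j i) 0 ≤ 0 := fun i => min_le_right _ _
  constructor
  · refine max_le_max le_rfl (add_le_add (Finset.sum_le_sum fun i _ => ?_) le_rfl)
    exact add_le_add (mul_le_mul_of_nonneg_left (hu i) (hp i))
      (mul_le_mul_of_nonpos_left (hl i) (hm i))
  · refine max_le_max le_rfl (add_le_add (Finset.sum_le_sum fun i _ => ?_) le_rfl)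
    exact add_le_add (mul_le_mul_of_nonneg_left (hl i) (hp i))
      (mul_le_mul_of_nonpos_left (hu i) (hm i))
end

section
/- Consider a feedforward ReLU network with layers 1,…,L, weight matrices W^{(ℓ)} ∈ ℝ^{n_{ℓ+1}×n_ℓ} and biases b^{(ℓ+1)}. For each layer ℓ let rep^{(ℓ)} : {1,…,n_ℓ} → {1,…,n_ℓ} be an idempotent cluster-representative map and ε^{(ℓ)} ∈ ℝ^{n_ℓ} nonnegative, with rep^{(1)} the identity and ε^{(1)} = 0. Given an input x and perturbation δ ≥ 0, define the original bounds by u^{(1)} = x + δ, l^{(1)} = x − δ and u^{(ℓ+1)}_j = max(0, Σ_i [(W^{(ℓ)}_{ji})⁺·u^{(ℓ)}_i + (W^{(ℓ)}_{ji})⁻·l^{(ℓ)}_i] + b^{(ℓ+1)}_j), l^{(ℓ+1)}_j = max(0, Σ_i [(W^{(ℓ)}_{ji})⁺·l^{(ℓ)}_i + (W^{(ℓ)}_{ji})⁻·u^{(ℓ)}_i] + b^{(ℓ+1)}_j); and define the abstract bounds by û^{(1)} = x + δ, l̂^{(1)} = x − δ and û^{(ℓ+1)}_j = max(0, Σ_i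 [(W^{(ℓ)}_{ji})⁺·(û^{(ℓ)}_{rep^{(ℓ)}(i)} + ε^{(ℓ)}_{rep^{(ℓ)}(i)}) + (W^{(ℓ)}_{ji})⁻·(l̂^{(ℓ)}_{rep^{(ℓ)}(i)} − ε^{(ℓ)}_{rep^{(ℓ)}(i)})] + b^{(ℓ+1)}_j), l̂^{(ℓ+1)}_j = max(0, Σ_i [(W^{(ℓ)}_{ji})⁺·(l̂^{(ℓ)}_{rep^{(ℓ)}(i)} − ε^{(ℓ)}_{rep^{(ℓ)}(i)}) + (W^{(ℓ)}_{ji})⁻·(û^{(ℓ)}_{rep^{(ℓ)}(i)} + ε^{(ℓ)}_{rep^{(ℓ)}(i)})] + b^{(ℓ+1)}_j). Assume that for every layer ℓ and every index i, u^{(ℓ)}_i ≤ u^{(ℓ)}_{rep^{(ℓ)}(i)} + ε^{(ℓ)}_{rep^{(ℓ)}(i)} and l^{(ℓ)}_i ≥ l^{(ℓ)}_{rep^{(ℓ)}(i)} − ε^{(ℓ)}_{rep^{(ℓ)}(i)}. Then for every layer ℓ and every index j, l̂^{(ℓ)}_j ≤ l^{(ℓ)}_j and û^{(ℓ)}_j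 ≥ u^{(ℓ)}_j; in particular the abstract output interval [l̂^{(L)}, û^{(L)}] contains the original output interval [l^{(L)}, u^{(L)}]. -/
/-- **Proof-lifting theorem (Theorem 3).** Layers are indexed `0, …, L` with `0` the input
layer. `u, l` are the interval bounds propagated through the original ReLU network from the
input box `[x - δ, x + δ]`, and `û, l̂` are the abstract bounds computed from the cluster
representatives (given by the idempotent maps `rep ℓ`, identity at the input layer) inflated
by the cluster radii `ε ℓ ≥ 0` (zero at the input layer). Assuming every neuron's original
bounds lie within `ε` of its representative's original bounds, the abstract bounds dominate
the original ones at every layer: `l̂ ≤ l` and `u ≤ û` componentwise, so in particular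
`[l̂^{(L)}, û^{(L)}] ⊇ [l^{(L)}, u^{(L)}]`. -/
theorem proof_lifting (n : ℕ → ℕ) (L : ℕ)
    (W : ∀ ℓ : ℕ, Matrix (Fin (n (ℓ + 1))) (Fin (n ℓ)) ℝ)
    (b : ∀ ℓ : ℕ, Fin (n (ℓ + 1)) → ℝ)
    (rep : ∀ ℓ : ℕ, Fin (n ℓ) → Fin (n ℓ))
    (hrep : ∀ ℓ i, rep ℓ (rep ℓ i) = rep ℓ i)
    (hrep0 : ∀ i, rep 0 i = i)
    (ε : ∀ ℓ : ℕ, Fin (n ℓ) → ℝ)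
    (hε : ∀ ℓ i, 0 ≤ ε ℓ i) (hε0 : ∀ i, ε 0 i = 0)
    (x δ : Fin (n 0) → ℝ) (hδ : ∀ i, 0 ≤ δ i)
    (u l uh lh : ∀ ℓ : ℕ, Fin (n ℓ) → ℝ)
    (hu0 : ∀ i, u 0 i = x i + δ i) (hl0 : ∀ i, l 0 i = x i - δ i)
    (huh0 : ∀ i, uh 0 i = x i + δ i) (hlh0 : ∀ i, lh 0 i = x i - δ i)
    (hu : ∀ ℓ < L, ∀ j, u (ℓ + 1) j =
      max 0 ((∑ i, (max 0 (W ℓ j i) * u ℓ i + min (W ℓ j i) 0 * l ℓ i)) + b ℓ j))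
    (hl : ∀ ℓ < L, ∀ j, l (ℓ + 1) j =
      max 0 ((∑ i, (max 0 (W ℓ j i) * l ℓ i + min (W ℓ j i) 0 * u ℓ i)) + b ℓ j))
    (huh : ∀ ℓ < L, ∀ j, uh (ℓ + 1) j =
      max 0 ((∑ i, (max 0 (W ℓ j i) * (uh ℓ (rep ℓ i) + ε ℓ (rep ℓ i))
        + min (W ℓ j i) 0 * (lh ℓ (rep ℓ i) - ε ℓ (rep ℓ i)))) + b ℓ j))
    (hlh : ∀ ℓ < L, ∀ j, lh (ℓ + 1) j =
      max 0 ((∑ i, (max 0 (W ℓ j i) * (lh ℓ (rep ℓ i) - ε ℓ (rep ℓ i))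
        + min (W ℓ j i) 0 * (uh ℓ (rep ℓ i) + ε ℓ (rep ℓ i)))) + b ℓ j))
    (hclu : ∀ ℓ ≤ L, ∀ i, u ℓ i ≤ u ℓ (rep ℓ i) + ε ℓ (rep ℓ i))
    (hcll : ∀ ℓ ≤ L, ∀ i, l ℓ (rep ℓ i) - ε ℓ (rep ℓ i) ≤ l ℓ i) :
    ∀ ℓ ≤ L, ∀ j, lh ℓ j ≤ l ℓ j ∧ u ℓ j ≤ uh ℓ j := by
  intro ℓ
  induction ℓ with
  | zero =>
    intro _ j
    rw [hlh0, hl0, hu0, huh0]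
    exact ⟨le_rfl, le_rfl⟩
  | succ k ih =>
    intro hk j
    have hkL : k < L := hk
    have ih' := ih hkL.le
    have h1 : ∀ i, u k i ≤ uh k (rep k i) + ε k (rep k i) := fun i => by
      linarith [hclu k hkL.le i, (ih' (rep k i)).2]
    have h2 : ∀ i, lh k (rep k i) - ε k (rep k i) ≤ l k i := fun i => by
      linarith [hcll k hkL.le i, (ih' (rep k i)).1]
    rw [hlh k hkL, hl k hkL, hu k hkL, huh k hkL]
    constructor
    · refine max_le_max le_rfl (add_le_add (Finset.sum_le_sum fun i _ => ?_) le_rfl)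
      exact add_le_add (mul_le_mul_of_nonneg_left (h2 i) (le_max_left _ _))
        (mul_le_mul_of_nonpos_left (h1 i) (min_le_right _ _))
    · refine max_le_max le_rfl (add_le_add (Finset.sum_le_sum fun i _ => ?_) le_rfl)
      exact add_le_add (mul_le_mul_of_nonneg_left (h1 i) (le_max_left _ _))
        (mul_le_mul_of_nonpos_left (h2 i) (min_le_right _ _))
end
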